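/- Suppose α, ω₁, ω₂ are pairwise distinct complex numbers each satisfying x³ = r·x² + s·x + t. Then for every natural number n, M_h(n) = ((α−ω₁)·(α−ω₂))⁻¹·αⁿ·(M_h(2) − (ω₁+ω₂)·M_h(1) + ω₁·ω₂·M_h(0)) − ((α−ω₁)·(ω₁−ω₂))⁻¹·ω₁ⁿ·(M_h(2) − (α+ω₂)·M_h(1) + α·ω₂·M_h(0)) + ((α−ω₂)·(ω₁−ω₂))⁻¹·ω₂ⁿ·(M_h(2) − (α+ω₁)·M_h(1) + α·ω₁·M_h(0)). -/

import Mathlib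

/-- Binet's formula for a third-order linear recurrence with values in a vector space, when the
characteristic polynomial has three distinct roots `a`, `b`, `c`. -/
theorem binet_of_third_order_recurrence {K V : Type*} [Field K] [AddCommGroup V] [Module K V]
    {r s t : K} {u : ℕ → V}
    (hu : ∀ n, u (n + 3) = r • u (n + 2) + s • u (n + 1) + t • u n)
    {a b c : K} (hab : a ≠ b) (hac : a ≠ c) (hbc : b ≠ c)
    (ha : a ^ 3 = r * a ^ 2 + s * a + t)
    (hb : b ^ 3 = r * b ^ 2 + s * b + t)
    (hc : c ^ 3 = r * c ^ 2 + s * c + t) (n : ℕ) :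
    u n = (((a - b) * (a - c))⁻¹ * a ^ n) • (u 2 - (b + c) • u 1 + (b * c) • u 0)
        - (((a - b) * (b - c))⁻¹ * b ^ n) • (u 2 - (a + c) • u 1 + (a * c) • u 0)
        + (((a - c) * (b - c))⁻¹ * c ^ n) • (u 2 - (a + b) • u 1 + (a * b) • u 0) := by
  have hab' := sub_ne_zero.2 hab
  have hac' := sub_ne_zero.2 hac
  have hbc' := sub_ne_zero.2 hbc
  induction n using Nat.strong_induction_on with
  | _ n ih =>
    match n with
    | 0 => match_scalars <;> field_simp <;> ring
    | 1 => match_scalars <;> field_simp <;> ring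
    | 2 => match_scalars <;> field_simp <;> ring
    | k + 3 =>
      rw [hu, ih (k + 2) (by lia), ih (k + 1) (by lia), ih k (by lia),
        pow_add a k 3, pow_add b k 3, pow_add c k 3, ha, hb, hc]
      generalize u 2 - (b + c) • u 1 + (b * c) • u 0 = x
      generalize u 2 - (a + c) • u 1 + (a * c) • u 0 = y
      generalize u 2 - (a + b) • u 1 + (a * b) • u 0 = z
      module

theorem stmt_5 (r s t : ℂ)
    (M : ℕ → Matrix (Fin 3) (Fin 3) ℂ)
    (hM0 : M 0 = 1)
    (hM1 : M 1 = !![r, s, t; 1, 0, 0; 0, 1, 0])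
    (hM2 : M 2 = !![r ^ 2 + s, r * s + t, r * t; r, s, t; 1, 0, 0])
    (hMrec : ∀ n, M (n + 3) = r • M (n + 2) + s • M (n + 1) + t • M n)
    (α ω₁ ω₂ : ℂ)
    (hαω₁ : α ≠ ω₁) (hαω₂ : α ≠ ω₂) (hω₁ω₂ : ω₁ ≠ ω₂)
    (hα : α ^ 3 = r * α ^ 2 + s * α + t)
    (hω₁ : ω₁ ^ 3 = r * ω₁ ^ 2 + s * ω₁ + t)
    (hω₂ : ω₂ ^ 3 = r * ω₂ ^ 2 + s * ω₂ + t)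
    (n : ℕ) :
    M n = (((α - ω₁) * (α - ω₂))⁻¹ * α ^ n) • (M 2 - (ω₁ + ω₂) • M 1 + (ω₁ * ω₂) • M 0)
        - (((α - ω₁) * (ω₁ - ω₂))⁻¹ * ω₁ ^ n) • (M 2 - (α + ω₂) • M 1 + (α * ω₂) • M 0)
        + (((α - ω₂) * (ω₁ - ω₂))⁻¹ * ω₂ ^ n) • (M 2 - (α + ω₁) • M 1 + (α * ω₁) • M 0) := by
  exact binet_of_third_order_recurrence hMrec hαω₁ hαω₂ hω₁ω₂ hα hω₁ hω₂ n
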